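/- Let N ≥ 1 and let Ω be an open subset of the open unit ball B = {x ∈ ℝ^N : |x| < 1}. Then for every measurable function u : B → [0,∞], ∫_Ω u(x) (2/(1−|x|²))^N dx = ∫_{exp_0^{-1}(Ω)} u(exp_0(z)) · Υ(z) dz, where Υ(z) = 2 (sinh(2|z|)/|z|)^{N−1} for z ≠ 0 and Υ(0) = 2^N, and both integrals are with respect to Lebesgue measure. -/

import Mathlib

/-- The exponential map at the origin of the Poincaré ball model:
`exp_0(z) = (sinh(2|z|)/((1 + cosh(2|z|)) |z|)) • z`, with `exp_0(0) = 0`. -/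
noncomputable def expZero {N : ℕ} (z : EuclideanSpace ℝ (Fin N)) : EuclideanSpace ℝ (Fin N) :=
  (Real.sinh (2 * ‖z‖) / ((1 + Real.cosh (2 * ‖z‖)) * ‖z‖)) • z

open Classical in
/-- The Jacobian factor `Υ(z) = 2 (sinh(2|z|)/|z|)^{N-1}` (with `Υ(0) = 2^N`). -/
noncomputable def Ups (N : ℕ) (z : EuclideanSpace ℝ (Fin N)) : ℝ :=
  if z = 0 then 2 ^ N else 2 * (Real.sinh (2 * ‖z‖) / ‖z‖) ^ (N - 1)

open MeasureTheory Set

theorem hasFDerivAt_norm_of_ne_zero {E : Type*} [NormedAddCommGroup E] [InnerProductSpace ℝ E]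
    {x : E} (hx : x ≠ 0) : HasFDerivAt (fun z : E => ‖z‖) (‖x‖⁻¹ • innerSL ℝ x) x := by
  have h := (hasStrictFDerivAt_norm_sq x).hasFDerivAt.sqrt (by simpa using hx)
  simp only [Real.sqrt_sq (norm_nonneg _)] at h
  refine h.congr_fderiv ?_
  ext v
  simp
  field_simp

/-- The derivative of the radial map `z ↦ g ‖z‖ • z` away from the origin. -/
theorem hasFDerivAt_radial {E : Type*} [NormedAddCommGroup E] [InnerProductSpace ℝ E]
    {x : E} (hx : x ≠ 0) {g : ℝ → ℝ} {g' : ℝ} (hg : HasDerivAt g g' ‖x‖) :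
    HasFDerivAt (fun z : E => g ‖z‖ • z)
      (g ‖x‖ • ContinuousLinearMap.id ℝ E + ((g' * ‖x‖⁻¹) • innerSL ℝ x).smulRight x) x := by
  refine ((hg.comp_hasFDerivAt x (hasFDerivAt_norm_of_ne_zero hx)).smul
    (hasFDerivAt_id x)).congr_fderiv ?_
  ext v
  simp [mul_assoc]

theorem det_smul_id_add_smulRight {E : Type*} [NormedAddCommGroup E] [InnerProductSpace ℝ E]
    [FiniteDimensional ℝ E] {a : ℝ} (ha : a ≠ 0) (f : E →L[ℝ] ℝ) (v : E) :
    (a • ContinuousLinearMap.id ℝ E + f.smulRight v).det =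
      a ^ Module.finrank ℝ E * (1 + a⁻¹ * f v) := by
  have h : ((a • ContinuousLinearMap.id ℝ E + f.smulRight v : E →L[ℝ] E) : E →ₗ[ℝ] E) =
      a • LinearMap.transvection (a⁻¹ • (f : E →ₗ[ℝ] ℝ)) v := by
    ext w
    simp [LinearMap.transvection.apply, smul_smul, ha]
  rw [ContinuousLinearMap.det, h, LinearMap.det_smul, LinearMap.transvection.det]
  simp

theorem Real.sinh_two_mul_div_one_add_cosh_two_mul (r : ℝ) :
    Real.sinh (2 * r) / (1 + Real.cosh (2 * r)) = Real.tanh r := by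
  have := Real.cosh_pos r
  rw [Real.sinh_two_mul, Real.cosh_two_mul, Real.tanh_eq_sinh_div_cosh, Real.sinh_sq,
    show 1 + (Real.cosh r ^ 2 + (Real.cosh r ^ 2 - 1)) = 2 * Real.cosh r ^ 2 by ring]
  field_simp

theorem Real.hasDerivAt_tanh (r : ℝ) : HasDerivAt Real.tanh (1 / Real.cosh r ^ 2) r := by
  have h := (Real.hasDerivAt_sinh r).div (Real.hasDerivAt_cosh r) (Real.cosh_pos r).ne'
  rw [show Real.tanh = Real.sinh / Real.cosh from funext Real.tanh_eq_sinh_div_cosh]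
  refine h.congr_deriv ?_
  rw [← Real.cosh_sq_sub_sinh_sq r]
  ring

theorem Real.tanh_pos {r : ℝ} (hr : 0 < r) : 0 < Real.tanh r := by
  rw [Real.tanh_eq_sinh_div_cosh]
  exact div_pos (Real.sinh_pos_iff.2 hr) (Real.cosh_pos r)

theorem expZero_eq_tanh {N : ℕ} (z : EuclideanSpace ℝ (Fin N)) :
    expZero z = (Real.tanh ‖z‖ / ‖z‖) • z := by
  rw [expZero, ← div_div, Real.sinh_two_mul_div_one_add_cosh_two_mul]

theorem norm_expZero {N : ℕ} (z : EuclideanSpace ℝ (Fin N)) :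
    ‖expZero z‖ = Real.tanh ‖z‖ := by
  rcases eq_or_ne z 0 with rfl | hz
  · simp [expZero]
  · have h := norm_pos_iff.2 hz
    rw [expZero_eq_tanh, norm_smul, Real.norm_of_nonneg (div_pos (Real.tanh_pos h) h).le,
      div_mul_cancel₀ _ h.ne']

theorem expZero_eq_zero {N : ℕ} {z : EuclideanSpace ℝ (Fin N)} : expZero z = 0 ↔ z = 0 := by
  rw [← norm_eq_zero, norm_expZero, ← norm_eq_zero (a := z), ← Real.tanh_zero,
    Real.tanh_injective.eq_iff, Real.tanh_zero]

theorem expZero_injective {N : ℕ} :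
    Function.Injective (expZero : EuclideanSpace ℝ (Fin N) → EuclideanSpace ℝ (Fin N)) := by
  intro x y hxy
  have hn : ‖x‖ = ‖y‖ := Real.tanh_injective (by rw [← norm_expZero, ← norm_expZero, hxy])
  rcases eq_or_ne x 0 with rfl | hx
  · exact (norm_eq_zero.1 (hn.symm.trans norm_zero)).symm
  · have h := norm_pos_iff.2 hx
    rw [expZero_eq_tanh, expZero_eq_tanh, ← hn] at hxy
    exact smul_right_injective _ (div_pos (Real.tanh_pos h) h).ne' hxy

theorem exists_expZero_eq {N : ℕ} {x : EuclideanSpace ℝ (Fin N)} (hx : ‖x‖ < 1) :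
    ∃ z, expZero z = x := by
  rcases eq_or_ne x 0 with rfl | h0
  · exact ⟨0, expZero_eq_zero.2 rfl⟩
  have hp := norm_pos_iff.2 h0
  have ha := Real.artanh_pos ⟨hp, hx⟩
  have hn : ‖(Real.artanh ‖x‖ / ‖x‖) • x‖ = Real.artanh ‖x‖ := by
    rw [norm_smul, Real.norm_of_nonneg (div_pos ha hp).le, div_mul_cancel₀ _ hp.ne']
  refine ⟨(Real.artanh ‖x‖ / ‖x‖) • x, ?_⟩
  rw [expZero_eq_tanh, hn, Real.tanh_artanh ⟨by linarith, hx⟩, smul_smul,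
    div_mul_div_cancel₀ ha.ne', div_self hp.ne', one_smul]

theorem measurable_expZero {N : ℕ} :
    Measurable (expZero : EuclideanSpace ℝ (Fin N) → EuclideanSpace ℝ (Fin N)) := by
  unfold expZero
  fun_prop

/-- Away from the origin, `expZero` is differentiable with Jacobian determinant
`(tanh ‖z‖ / ‖z‖) ^ (N - 1) / cosh ‖z‖ ^ 2`. -/
theorem exists_hasFDerivAt_expZero {N : ℕ} (hN : 1 ≤ N) {z : EuclideanSpace ℝ (Fin N)}
    (hz : z ≠ 0) : ∃ f' : EuclideanSpace ℝ (Fin N) →L[ℝ] EuclideanSpace ℝ (Fin N),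
      HasFDerivAt expZero f' z ∧
        f'.det = (Real.tanh ‖z‖ / ‖z‖) ^ (N - 1) * (1 / Real.cosh ‖z‖ ^ 2) := by
  have hp := norm_pos_iff.2 hz
  have ht := Real.tanh_pos hp
  have hc := Real.cosh_pos ‖z‖
  have hg := (Real.hasDerivAt_tanh ‖z‖).fun_div (hasDerivAt_id' ‖z‖) hp.ne'
  have hf := hasFDerivAt_radial hz hg
  simp only [← expZero_eq_tanh] at hf
  refine ⟨_, hf, ?_⟩
  obtain ⟨n, rfl⟩ := Nat.exists_eq_add_of_le' hN
  rw [det_smul_id_add_smulRight (div_pos ht hp).ne', finrank_euclideanSpace, Fintype.card_fin,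
    Nat.add_sub_cancel, pow_succ, mul_assoc]
  congr 1
  simp
  field_simp
  ring

theorem jacobian_mul_density_eq_Ups {N : ℕ} (hN : 1 ≤ N) {z : EuclideanSpace ℝ (Fin N)}
    (hz : z ≠ 0) :
    (Real.tanh ‖z‖ / ‖z‖) ^ (N - 1) * (1 / Real.cosh ‖z‖ ^ 2) *
      (2 / (1 - ‖expZero z‖ ^ 2)) ^ N = Ups N z := by
  have hp := norm_pos_iff.2 hz
  have hc := Real.cosh_pos ‖z‖
  have h : 2 / (1 - ‖expZero z‖ ^ 2) = 2 * Real.cosh ‖z‖ ^ 2 := by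
    have h1 : 1 - Real.tanh ‖z‖ ^ 2 = 1 / Real.cosh ‖z‖ ^ 2 := by
      rw [Real.tanh_eq_sinh_div_cosh]
      field_simp
      exact Real.cosh_sq_sub_sinh_sq _
    rw [norm_expZero, h1, div_div_eq_mul_div, div_one]
  obtain ⟨n, rfl⟩ := Nat.exists_eq_add_of_le' hN
  rw [h, Ups, if_neg hz, Nat.add_sub_cancel, pow_succ (2 * _) n, Real.sinh_two_mul]
  have h2 : 2 * Real.sinh ‖z‖ * Real.cosh ‖z‖ / ‖z‖ =
      Real.tanh ‖z‖ / ‖z‖ * (2 * Real.cosh ‖z‖ ^ 2) := by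
    rw [Real.tanh_eq_sinh_div_cosh]
    field_simp
  rw [h2, mul_pow (_ / _)]
  field_simp

/-- Change of variables for the exponential map at the origin: for any open `Ω` inside the unit
ball and any nonnegative measurable `u`,
`∫_Ω u dV_{𝔹^N} = ∫_{exp_0⁻¹(Ω)} u(exp_0 z) Υ(z) dz`. -/
theorem change_of_variable_expZero
    (N : ℕ) (hN : 1 ≤ N) (Ω : Set (EuclideanSpace ℝ (Fin N)))
    (hΩopen : IsOpen Ω) (hΩ : Ω ⊆ {x : EuclideanSpace ℝ (Fin N) | ‖x‖ < 1})
    (u : EuclideanSpace ℝ (Fin N) → ENNReal) (hu : Measurable u) :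
    ∫⁻ x in Ω, u x * ENNReal.ofReal ((2 / (1 - ‖x‖ ^ 2)) ^ N) =
      ∫⁻ z in expZero ⁻¹' Ω, u (expZero z) * ENNReal.ofReal (Ups N z) := by
  have : Nonempty (Fin N) := ⟨⟨0, hN⟩⟩
  have hnull : ∀ s : Set (EuclideanSpace ℝ (Fin N)), (s \ {0} : Set (EuclideanSpace ℝ (Fin N))) =ᵐ[volume] s := fun s =>
    sdiff_null_ae_eq_self (measure_singleton 0)
  have himage : expZero '' (expZero ⁻¹' Ω \ {0}) = Ω \ {0} := by
    ext x
    constructor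
    · rintro ⟨z, ⟨hz, hz0⟩, rfl⟩
      exact ⟨hz, fun h => hz0 (expZero_eq_zero.1 h)⟩
    · rintro ⟨hx, hx0⟩
      obtain ⟨z, rfl⟩ := exists_expZero_eq (hΩ hx)
      exact ⟨z, ⟨hx, fun h => hx0 (expZero_eq_zero.2 h)⟩, rfl⟩
  have hmeas : MeasurableSet (expZero ⁻¹' Ω \ {0}) :=
    (measurable_expZero hΩopen.measurableSet).diff (measurableSet_singleton 0)
  choose! f' hf' hdet using
    fun z : EuclideanSpace ℝ (Fin N) => exists_hasFDerivAt_expZero (z := z) hN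
  rw [← setLIntegral_congr (hnull Ω), ← setLIntegral_congr (hnull (expZero ⁻¹' Ω)), ← himage,
    lintegral_image_eq_lintegral_abs_det_fderiv_mul volume hmeas
      (fun z hz => (hf' z hz.2).hasFDerivWithinAt) expZero_injective.injOn]
  refine setLIntegral_congr_fun hmeas fun z hz => ?_
  have hp := norm_pos_iff.2 hz.2
  have ht := Real.tanh_pos hp
  have hdet0 : 0 ≤ (f' z).det := by
    rw [hdet z hz.2]
    positivity
  rw [abs_of_nonneg hdet0, mul_left_comm, ← ENNReal.ofReal_mul hdet0, hdet z hz.2,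
    jacobian_mul_density_eq_Ups hN hz.2]
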